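/- Let (𝒫, 𝒩) be a Beurling generalized number system whose integers are θ-well-behaved for some θ ∈ [0,1), and suppose that for some real k ≥ 1/2 and some c > 0 one has (1/T) ∫_{−T}^{T} |ζ_𝒫((1+θ)/2 + iv)|^{2k} dv ≪_k (log T)^c for all T ≥ 2. Then there is a constant c' (depending on k and c) such that for all T ≥ 2, N ≥ 2, all 1-well-spaced points t_1, …, t_R ∈ [0, T], and all complex a_j, the Dirichlet polynomial S(it) = ∑_{N < n_j ≤ 2N} a_j n_j^{−it} satisfies ∑_{r=1}^R |S(it_r)|² ≪_k (N + N^{(1+θ)/2} T^{1/(2k)} R^{(2k−1)/(2k)} (log T)^{c'}) ∑_{N < n_j ≤ 2N} |a_j|². -/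

import Mathlib

open Filter Asymptotics

/-- A Beurling generalized number system: a nondecreasing sequence of generalized
primes `p` with `1 < p 0` tending to infinity, together with the nondecreasing
enumeration `n` (with multiplicity) of all finite products of the generalized primes,
witnessed by the bijection `equiv` from exponent vectors to indices. -/
structure BeurlingSystem where
  p : ℕ → ℝ
  n : ℕ → ℝ
  one_lt_p : 1 < p 0
  mono_p : Monotone p
  tendsto_p : Tendsto p atTop atTop
  mono_n : Monotone n
  equiv : (ℕ →₀ ℕ) ≃ ℕ
  n_eq : ∀ k : ℕ →₀ ℕ, n (equiv k) = ∏ j ∈ k.support, p j ^ k j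

/-- The integer counting function `N_𝒫(x)`. -/
noncomputable def BeurlingSystem.Nint (S : BeurlingSystem) (x : ℝ) : ℕ :=
  {j : ℕ | S.n j ≤ x}.ncard

/-- `Z` is an analytic continuation of the Beurling zeta function of the system `S`
to the half-plane `Re s > θ`, with density `A`: it agrees with the Dirichlet series
on `Re s > 1` and `Z s - A/(s-1)` is analytic on `Re s > θ`. -/
def BeurlingSystem.IsZeta (S : BeurlingSystem) (θ A : ℝ) (Z : ℂ → ℂ) : Prop :=
  (∀ s : ℂ, 1 < s.re → Z s = ∑' j : ℕ, (S.n j : ℂ) ^ (-s)) ∧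
    DifferentiableOn ℂ (fun s => Z s - (A : ℂ) / (s - 1)) {s : ℂ | θ < s.re}

/-- The number of zeros (without multiplicity) of `Z` with `α ≤ Re ρ` and `|Im ρ| ≤ T`. -/
noncomputable def zeroCount (Z : ℂ → ℂ) (α T : ℝ) : ℕ :=
  {ρ : ℂ | Z ρ = 0 ∧ α ≤ ρ.re ∧ |ρ.im| ≤ T}.ncard

open MeasureTheory Set Topology

namespace BeurlingSystem

variable (S : BeurlingSystem)

theorem one_le_n (j : ℕ) : 1 ≤ S.n j := by
  obtain ⟨k, rfl⟩ := S.equiv.surjective j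
  rw [S.n_eq]
  exact Finset.one_le_prod fun i _ => one_le_pow₀ (S.one_lt_p.le.trans (S.mono_p (Nat.zero_le i)))

variable {S}

theorem finite_setOf_n_le {θ A : ℝ} (hθ1 : θ < 1) (hA : 0 < A)
    (hwb : (fun x : ℝ => (S.Nint x : ℝ) - A * x) =O[atTop] fun x : ℝ => x ^ θ) (x : ℝ) :
    {j : ℕ | S.n j ≤ x}.Finite := by
  by_contra hinf
  have h0 : ∀ y, x ≤ y → S.Nint y = 0 := fun y hy =>
    Set.Infinite.ncard (Set.Infinite.mono (fun j (hj : S.n j ≤ x) => hj.trans hy) hinf)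
  have h1 : (fun y : ℝ => y ^ (1 : ℝ)) =O[atTop] fun y : ℝ => y ^ θ := by
    refine IsBigO.trans ?_ hwb
    refine IsBigO.of_bound A⁻¹ ?_
    filter_upwards [eventually_ge_atTop x] with y hy
    rw [h0 y hy]
    simp [abs_of_pos hA, ← mul_assoc, inv_mul_cancel₀ hA.ne']
  obtain ⟨c, hc⟩ := h1.bound
  have h2 := (tendsto_rpow_atTop (sub_pos.2 hθ1)).eventually_gt_atTop c
  obtain ⟨y, h3, h4, h5⟩ := (hc.and (h2.and (eventually_gt_atTop 0))).exists
  rw [Real.rpow_sub h5, Real.rpow_one, lt_div_iff₀ (Real.rpow_pos_of_pos h5 _)] at h4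
  rw [Real.rpow_one, Real.norm_of_nonneg h5.le, Real.norm_of_nonneg (by positivity)] at h3
  linarith

theorem monotone_Nint (hfin : ∀ x, {j : ℕ | S.n j ≤ x}.Finite) : Monotone S.Nint :=
  fun _ y hxy => Set.ncard_le_ncard (fun _ hj => le_trans hj hxy) (hfin y)

theorem Nint_eq_zero {x : ℝ} (hx : x < 1) : S.Nint x = 0 := by
  have : {j : ℕ | S.n j ≤ x} = ∅ := by
    ext j
    simpa using hx.trans_le (S.one_le_n j)
  simp [Nint, this]

theorem exists_abs_Nint_sub_le {θ A : ℝ} (hθ0 : 0 ≤ θ) (hθ1 : θ < 1) (hA : 0 < A)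
    (hwb : (fun x : ℝ => (S.Nint x : ℝ) - A * x) =O[atTop] fun x : ℝ => x ^ θ) :
    ∃ C : ℝ, 0 ≤ C ∧ ∀ x, 1 ≤ x → |(S.Nint x : ℝ) - A * x| ≤ C * x ^ θ := by
  have hmono := monotone_Nint (finite_setOf_n_le hθ1 hA hwb)
  obtain ⟨c, hc⟩ := hwb.bound
  obtain ⟨X, hX⟩ := eventually_atTop.1 hc
  refine ⟨max c (S.Nint X + A * |X|), ?_, fun x hx => ?_⟩
  · exact le_max_of_le_right (by positivity)
  have hx0 : 0 < x := by linarith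
  rcases le_total X x with h | h
  · have := hX x h
    rw [Real.norm_eq_abs, Real.norm_of_nonneg (by positivity)] at this
    exact this.trans (by gcongr; exact le_max_left _ _)
  · have h1 : (S.Nint x : ℝ) ≤ S.Nint X := by exact_mod_cast hmono h
    have h2 : 1 ≤ x ^ θ := Real.one_le_rpow hx hθ0
    have h3 : A * x ≤ A * |X| := by gcongr; exact h.trans (le_abs_self X)
    have h4 : (0 : ℝ) ≤ S.Nint x := by positivity
    have h5 : 0 < A * x := by positivity
    calc |(S.Nint x : ℝ) - A * x| ≤ S.Nint X + A * |X| := abs_le.2 ⟨by linarith, by linarith⟩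
      _ ≤ max c (S.Nint X + A * |X|) := le_max_right _ _
      _ ≤ _ := le_mul_of_one_le_right (le_max_of_le_right (by positivity)) h2

/-- Abel summation over the generalized integers, in the logarithmic variable. -/
theorem hasSum_comp_log_n (hfin : ∀ x, {j : ℕ | S.n j ≤ x}.Finite) {G G' : ℝ → ℂ}
    (hG : ∀ y, HasDerivAt G (G' y) y) (hc : Continuous G') (hlim : Tendsto G atTop (𝓝 0))
    (hG_int : Integrable fun y => G' y * (S.Nint (Real.exp y) : ℂ)) :
    HasSum (fun j => G (Real.log (S.n j))) (-∫ y, G' y * (S.Nint (Real.exp y) : ℂ)) := by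
  have hpos : ∀ j, 0 < S.n j := fun j => one_pos.trans_le (S.one_le_n j)
  have hle : ∀ j y, Real.log (S.n j) ≤ y ↔ S.n j ≤ Real.exp y := fun j y =>
    Real.log_le_iff_le_exp (hpos j)
  have hsum : ∀ {E : Type} [NormedAddCommGroup E] (z : E) (y : ℝ),
      HasSum (fun j => (Ici (Real.log (S.n j))).indicator (fun _ => z) y)
        ((S.Nint (Real.exp y)) • z) := by
    intro E _ z y
    have h := hasSum_sum_of_ne_finset_zero (L := .unconditional ℕ) (s := (hfin (Real.exp y)).toFinset)
      (f := fun j => (Ici (Real.log (S.n j))).indicator (fun _ => z) y) (fun j hj => by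
        simp only [Set.Finite.mem_toFinset, mem_ofPred_eq] at hj
        exact indicator_of_notMem (by simpa [hle] using hj) _)
    convert h using 1
    rw [Finset.sum_congr rfl (g := fun _ => z), Finset.sum_const, Nint,
      Set.ncard_eq_toFinset_card _ (hfin _)]
    intro j hj
    simp only [Set.Finite.mem_toFinset, mem_ofPred_eq] at hj
    exact indicator_of_mem (by simpa [hle] using hj) _
  have hI : ∀ j, IntegrableOn G' (Ici (Real.log (S.n j))) := by
    intro j
    refine Integrable.mono' hG_int.norm.integrableOn hc.aestronglyMeasurable ?_
    filter_upwards [ae_restrict_mem measurableSet_Ici] with y hy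
    have h1 : 1 ≤ S.Nint (Real.exp y) :=
      (Set.ncard_pos (hfin _)).2 ⟨j, (hle j y).1 hy⟩
    rw [norm_mul, Complex.norm_natCast]
    exact le_mul_of_one_le_right (norm_nonneg _) (by exact_mod_cast h1)
  have hterm : ∀ j, G (Real.log (S.n j)) =
      -∫ y, (Ici (Real.log (S.n j))).indicator G' y := by
    intro j
    rw [integral_indicator measurableSet_Ici, integral_Ici_eq_integral_Ioi,
      integral_Ioi_of_hasDerivAt_of_tendsto' (fun y _ => hG y)
        ((hI j).mono_set Ioi_subset_Ici_self) hlim]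
    simp
  simp_rw [hterm]
  refine HasSum.neg ?_
  have hb : ∀ y, HasSum (fun j => (Ici (Real.log (S.n j))).indicator (fun y => ‖G' y‖) y)
      ‖G' y * (S.Nint (Real.exp y) : ℂ)‖ := by
    intro y
    have := hsum ‖G' y‖ y
    simpa [indicator, mul_comm] using this
  refine hasSum_integral_of_dominated_convergence
    (fun j => (Ici (Real.log (S.n j))).indicator fun y => ‖G' y‖) ?_ ?_ ?_ ?_ ?_
  · exact fun j => hc.aestronglyMeasurable.indicator measurableSet_Ici
  · exact fun j => Eventually.of_forall fun y => (norm_indicator_eq_indicator_norm _ _).le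
  · exact Eventually.of_forall fun y => (hb y).summable
  · simpa only [(hb _).tsum_eq] using hG_int.norm
  · refine Eventually.of_forall fun y => ?_
    have := hsum (G' y) y
    simpa [indicator, mul_comm] using this

end BeurlingSystem

namespace BeurlingSystem

/-- The discrepancy `N(e^y) - A e^y` of the integer counting function. -/
noncomputable def discrepancy (S : BeurlingSystem) (A y : ℝ) : ℝ :=
  S.Nint (Real.exp y) - A * Real.exp y

variable {S : BeurlingSystem}

theorem discrepancy_of_neg {A y : ℝ} (hy : y < 0) :
    S.discrepancy A y = -(A * Real.exp y) := by
  rw [discrepancy, Nint_eq_zero (Real.exp_lt_one_iff.2 hy)]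
  simp

theorem measurable_discrepancy (hfin : ∀ x, {j : ℕ | S.n j ≤ x}.Finite) (A : ℝ) :
    Measurable (S.discrepancy A) := by
  have : Monotone fun y : ℝ => (S.Nint (Real.exp y) : ℝ) := fun x y hxy => by
    exact Nat.cast_le.2 <| monotone_Nint hfin (Real.exp_le_exp.2 hxy)
  exact this.measurable.sub (by fun_prop)

/-- The Laplace transform of the discrepancy over the positive half-line. -/
noncomputable def discrepancyTransform (S : BeurlingSystem) (A : ℝ) (s : ℂ) : ℂ :=
  ∫ y in Ioi (0 : ℝ), (S.discrepancy A y : ℂ) * Complex.exp (-s * y)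

theorem norm_discrepancy_mul_exp_le {θ A C : ℝ}
    (hC : ∀ y, 0 ≤ y → |S.discrepancy A y| ≤ C * Real.exp (θ * y)) (s : ℂ) {y : ℝ}
    (hy : 0 ≤ y) :
    ‖(S.discrepancy A y : ℂ) * Complex.exp (-s * y)‖ ≤ C * Real.exp (-(s.re - θ) * y) := by
  rw [norm_mul, Complex.norm_real, Real.norm_eq_abs, Complex.norm_exp]
  calc _ ≤ C * Real.exp (θ * y) * Real.exp ((-s * y).re) := by gcongr; exact hC y hy
    _ = _ := by
      rw [mul_assoc, ← Real.exp_add]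
      congr 2
      simp
      ring

theorem aestronglyMeasurable_discrepancy_mul_exp (hfin : ∀ x, {j : ℕ | S.n j ≤ x}.Finite)
    (A : ℝ) (s : ℂ) (μ : Measure ℝ) : AEStronglyMeasurable
      (fun y : ℝ => (S.discrepancy A y : ℂ) * Complex.exp (-s * y)) μ :=
  ((Complex.measurable_ofReal.comp (measurable_discrepancy hfin A)).mul
    (by fun_prop)).aestronglyMeasurable

theorem integrableOn_discrepancy_mul_exp (hfin : ∀ x, {j : ℕ | S.n j ≤ x}.Finite) {θ A C : ℝ}
    (hC : ∀ y, 0 ≤ y → |S.discrepancy A y| ≤ C * Real.exp (θ * y)) {s : ℂ} (hs : θ < s.re) :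
    IntegrableOn (fun y : ℝ => (S.discrepancy A y : ℂ) * Complex.exp (-s * y)) (Ioi 0) := by
  refine Integrable.mono' ((exp_neg_integrableOn_Ioi 0 (sub_pos.2 hs)).const_mul C)
    (aestronglyMeasurable_discrepancy_mul_exp hfin A s _) ?_
  filter_upwards [ae_restrict_mem measurableSet_Ioi] with y hy
  exact norm_discrepancy_mul_exp_le hC s (mem_Ioi.1 hy).le

theorem differentiableOn_discrepancyTransform (hfin : ∀ x, {j : ℕ | S.n j ≤ x}.Finite)
    {θ A C : ℝ} (hC : ∀ y, 0 ≤ y → |S.discrepancy A y| ≤ C * Real.exp (θ * y)) :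
    DifferentiableOn ℂ (S.discrepancyTransform A) {s : ℂ | θ < s.re} := by
  intro s hs
  have hs : θ < s.re := hs
  set ε := (s.re - θ) / 2 with hε
  have hε0 : 0 < ε := by rw [hε]; linarith
  have hC0 : 0 ≤ C := by simpa using (abs_nonneg _).trans (hC 0 le_rfl)
  refine (hasDerivAt_integral_of_dominated_loc_of_deriv_le
    (F := fun (z : ℂ) (y : ℝ) => (S.discrepancy A y : ℂ) * Complex.exp (-z * y))
    (F' := fun (z : ℂ) (y : ℝ) => (S.discrepancy A y : ℂ) * Complex.exp (-z * y) * (-y))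
    (bound := fun y => C * (2 / ε) * Real.exp (-(ε / 2) * y))
    (Metric.ball_mem_nhds s hε0) ?_ (integrableOn_discrepancy_mul_exp hfin hC hs) ?_ ?_ ?_
    ?_).2.differentiableAt.differentiableWithinAt
  · exact Eventually.of_forall fun z => aestronglyMeasurable_discrepancy_mul_exp hfin A z _
  · exact (aestronglyMeasurable_discrepancy_mul_exp hfin A s _).mul
      (by fun_prop : Continuous fun y : ℝ => -(y : ℂ)).aestronglyMeasurable
  · filter_upwards [ae_restrict_mem measurableSet_Ioi] with y hy z hz
    have hy : 0 < y := hy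
    have h1 : θ + ε ≤ z.re := by
      have h2 := (Complex.abs_re_le_norm (z - s)).trans_lt (by simpa [dist_eq_norm] using hz)
      rw [Complex.sub_re] at h2
      have := (abs_lt.1 h2).1
      rw [hε] at this ⊢
      linarith
    have h3 : y ≤ 2 / ε * Real.exp (ε / 2 * y) := by
      have := Real.add_one_le_exp (ε / 2 * y)
      calc y = 2 / ε * (ε / 2 * y) := by field_simp
        _ ≤ _ := by gcongr; linarith
    rw [norm_mul, norm_neg, Complex.norm_real, Real.norm_of_nonneg hy.le]
    calc _ ≤ C * Real.exp (-(z.re - θ) * y) * (2 / ε * Real.exp (ε / 2 * y)) := by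
          gcongr
          exact norm_discrepancy_mul_exp_le hC z hy.le
      _ ≤ C * Real.exp (-ε * y) * (2 / ε * Real.exp (ε / 2 * y)) := by
          gcongr
          linarith
      _ = C * (2 / ε) * (Real.exp (-ε * y) * Real.exp (ε / 2 * y)) := by ring
      _ = _ := by rw [← Real.exp_add]; congr 2; ring
  · exact (exp_neg_integrableOn_Ioi 0 (half_pos hε0)).const_mul _
  · refine Eventually.of_forall fun y z _ => ?_
    have h : HasDerivAt (fun z : ℂ => -z * (y : ℂ)) (-(y : ℂ)) z := by
      simpa using (hasDerivAt_id z).neg.mul_const (y : ℂ)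
    simpa [mul_assoc] using (h.cexp.const_mul (S.discrepancy A y : ℂ))

theorem hasSum_n_cpow (hfin : ∀ x, {j : ℕ | S.n j ≤ x}.Finite) {θ A C : ℝ} (hθ1 : θ < 1)
    (hC : ∀ y, 0 ≤ y → |S.discrepancy A y| ≤ C * Real.exp (θ * y)) {s : ℂ} (hs : 1 < s.re) :
    HasSum (fun j => (S.n j : ℂ) ^ (-s)) (s * A / (s - 1) + s * S.discrepancyTransform A s) := by
  have hs1 : s - 1 ≠ 0 := fun h => by
    have := congrArg Complex.re h
    simp at this
    linarith
  have hre : (1 - s).re < 0 := by simpa using hs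
  have hind : (fun y : ℝ => -s * Complex.exp (-s * y) * (S.Nint (Real.exp y) : ℂ)) =
      (Ici (0 : ℝ)).indicator fun y : ℝ => -s * (A * Complex.exp ((1 - s) * y) +
        (S.discrepancy A y : ℂ) * Complex.exp (-s * y)) := by
    ext y
    by_cases hy : 0 ≤ y
    · rw [indicator_of_mem (mem_Ici.2 hy), discrepancy, sub_mul, one_mul, sub_eq_add_neg (y : ℂ),
        Complex.exp_add, neg_mul s]
      push_cast
      ring_nf
    · rw [indicator_of_notMem (by simpa using hy), Nint_eq_zero (Real.exp_lt_one_iff.2 (not_le.1 hy))]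
      simp
  have hi1 : IntegrableOn (fun y : ℝ => (A : ℂ) * Complex.exp ((1 - s) * y)) (Ioi 0) :=
    (integrableOn_exp_mul_complex_Ioi hre 0).const_mul _
  have hi2 := integrableOn_discrepancy_mul_exp hfin hC (hθ1.trans hs)
  have h := hasSum_comp_log_n hfin (G := fun y : ℝ => Complex.exp (-s * y))
    (G' := fun y : ℝ => -s * Complex.exp (-s * y)) ?_ (by fun_prop) ?_ ?_
  · convert h using 1
    · ext j
      have : 0 < S.n j := one_pos.trans_le (S.one_le_n j)
      rw [Complex.cpow_def_of_ne_zero (by exact_mod_cast this.ne'), Complex.ofReal_log this.le]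
      ring_nf
    · rw [hind, integral_indicator measurableSet_Ici, integral_Ici_eq_integral_Ioi,
        integral_const_mul, integral_add hi1 hi2, integral_const_mul,
        integral_exp_mul_complex_Ioi hre, discrepancyTransform]
      have : 1 - s ≠ 0 := fun h => hs1 (by linear_combination -h)
      simp
      field_simp
      ring
  · intro y
    have h : HasDerivAt (fun y : ℝ => -s * (y : ℂ)) (-s) y := by
      simpa using (Complex.ofRealCLM.hasDerivAt (x := y)).const_mul (-s)
    simpa [mul_comm] using h.cexp
  · rw [tendsto_zero_iff_norm_tendsto_zero]
    simp only [Complex.norm_exp]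
    refine Real.tendsto_exp_atBot.comp ?_
    simp
    exact Tendsto.const_mul_atTop (by linarith) tendsto_id
  · rw [hind, integrable_indicator_iff measurableSet_Ici, integrableOn_Ici_iff_integrableOn_Ioi]
    exact (hi1.add hi2).const_mul _

theorem IsZeta.eq_discrepancyTransform (hfin : ∀ x, {j : ℕ | S.n j ≤ x}.Finite) {θ A C : ℝ}
    (hθ1 : θ < 1) (hC : ∀ y, 0 ≤ y → |S.discrepancy A y| ≤ C * Real.exp (θ * y)) {Z : ℂ → ℂ}
    (hZ : S.IsZeta θ A Z) {s : ℂ} (hs : θ < s.re) (hs1 : s ≠ 1) :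
    Z s = s * A / (s - 1) + s * S.discrepancyTransform A s := by
  have hopen : IsOpen {s : ℂ | θ < s.re} := isOpen_lt continuous_const Complex.continuous_re
  have hconn : IsPreconnected {s : ℂ | θ < s.re} := (convex_halfSpace_re_gt θ).isPreconnected
  have hf := hZ.2.analyticOnNhd hopen
  have hg : AnalyticOnNhd ℂ (fun s => A + s * S.discrepancyTransform A s) {s : ℂ | θ < s.re} :=
    ((differentiableOn_const _).add (differentiableOn_id.mul
      (differentiableOn_discrepancyTransform hfin hC))).analyticOnNhd hopen
  have h2 : (2 : ℂ) ∈ {s : ℂ | θ < s.re} := by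
    simp
    linarith
  have heq := hf.eqOn_of_preconnected_of_eventuallyEq hg hconn h2 (by
    filter_upwards [(isOpen_lt continuous_const Complex.continuous_re).mem_nhds
      (by simp : (1 : ℝ) < (2 : ℂ).re)] with z hz
    have hz1 : z - 1 ≠ 0 := fun h => by
      have := congrArg Complex.re h
      simp at this

      linarith
    rw [hZ.1 z hz, (hasSum_n_cpow hfin hθ1 hC hz).tsum_eq]
    field_simp
    ring)
  have h := heq hs
  have hs1' : s - 1 ≠ 0 := sub_ne_zero.2 hs1
  rw [sub_eq_iff_eq_add] at h
  rw [h]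
  field_simp
  ring

theorem integrable_discrepancy_mul_exp (hfin : ∀ x, {j : ℕ | S.n j ≤ x}.Finite) {θ A C : ℝ}
    (hC : ∀ y, 0 ≤ y → |S.discrepancy A y| ≤ C * Real.exp (θ * y)) {s : ℂ} (hs : θ < s.re)
    (hs1 : s.re < 1) :
    Integrable (fun y : ℝ => (S.discrepancy A y : ℂ) * Complex.exp (-s * y)) := by
  rw [← integrableOn_univ, ← Iio_union_Ici (a := (0 : ℝ)), integrableOn_union,
    integrableOn_Ici_iff_integrableOn_Ioi]
  refine ⟨?_, integrableOn_discrepancy_mul_exp hfin hC hs⟩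
  refine IntegrableOn.congr_fun (f := fun y : ℝ => -(A * Complex.exp ((1 - s) * y))) ?_ ?_
    measurableSet_Iio
  · have hre : 0 < (1 - s).re := by simpa using hs1
    exact IntegrableOn.mono_set ((integrableOn_exp_mul_complex_Iic hre 0).const_mul _).neg
      Iio_subset_Iic_self
  · intro y hy
    simp only [discrepancy_of_neg hy, sub_mul, Complex.exp_sub, one_mul, neg_mul, Complex.exp_neg]
    push_cast
    ring

theorem IsZeta.eq_mul_integral (hfin : ∀ x, {j : ℕ | S.n j ≤ x}.Finite) {θ A C : ℝ}
    (hθ1 : θ < 1) (hC : ∀ y, 0 ≤ y → |S.discrepancy A y| ≤ C * Real.exp (θ * y)) {Z : ℂ → ℂ}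
    (hZ : S.IsZeta θ A Z) {s : ℂ} (hs : θ < s.re) (hs1 : s.re < 1) :
    Z s = s * ∫ y : ℝ, (S.discrepancy A y : ℂ) * Complex.exp (-s * y) := by
  have hne : s ≠ 1 := fun h => by simp [h] at hs1
  have h1 : 1 - s ≠ 0 := sub_ne_zero.2 hne.symm
  have h2 : s - 1 ≠ 0 := sub_ne_zero.2 hne
  have hi := integrable_discrepancy_mul_exp hfin hC hs hs1
  rw [hZ.eq_discrepancyTransform hfin hθ1 hC hs hne, discrepancyTransform,
    ← intervalIntegral.integral_Iic_add_Ioi hi.integrableOn hi.integrableOn (b := 0),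
    integral_Iic_eq_integral_Iio]
  have : ∫ y in Iio (0 : ℝ), (S.discrepancy A y : ℂ) * Complex.exp (-s * y) =
      ∫ y in Iio (0 : ℝ), -(A : ℂ) * Complex.exp ((1 - s) * y) := by
    refine setIntegral_congr_fun measurableSet_Iio fun y hy => ?_
    simp only [discrepancy_of_neg hy, sub_mul, Complex.exp_sub, one_mul, neg_mul, Complex.exp_neg]
    push_cast
    ring
  rw [this, integral_const_mul, ← integral_Iic_eq_integral_Iio,
    integral_exp_mul_complex_Iic (by simpa using hs1)]
  simp
  field_simp
  ring

end BeurlingSystem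

section Gaussian

theorem integrable_linear_mul_cexp_quadratic {b : ℂ} (hb : b.re < 0) (c d p q : ℂ) :
    Integrable fun x : ℝ => (p * x + q) * Complex.exp (b * x ^ 2 + c * x + d) := by
  refine Integrable.mono' (((integrable_cexp_quadratic' hb (c + 1) d).norm.add
    (integrable_cexp_quadratic' hb (c - 1) d).norm).const_mul (‖p‖ + ‖q‖))
    (by fun_prop) (Eventually.of_forall fun x => ?_)
  have h1 : ‖p * (x : ℂ) + q‖ ≤ (‖p‖ + ‖q‖) * Real.exp |x| := by
    have h2 := Real.add_one_le_exp |x|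
    have h3 := abs_nonneg x
    calc _ ≤ ‖p * (x : ℂ)‖ + ‖q‖ := norm_add_le _ _
      _ = ‖p‖ * |x| + ‖q‖ * 1 := by rw [norm_mul, Complex.norm_real, Real.norm_eq_abs, mul_one]
      _ ≤ ‖p‖ * Real.exp |x| + ‖q‖ * Real.exp |x| := by gcongr <;> linarith
      _ = _ := by ring
  have h4 : Real.exp |x| ≤ Real.exp x + Real.exp (-x) := by
    rcases abs_cases x with ⟨h, -⟩ | ⟨h, -⟩ <;> rw [h]
    · linarith [Real.exp_pos (-x)]
    · linarith [Real.exp_pos x]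
  have h5 : ∀ u : ℝ, ‖Complex.exp (b * x ^ 2 + (c + u) * x + d)‖ =
      Real.exp (u * x) * ‖Complex.exp (b * x ^ 2 + c * x + d)‖ := by
    intro u
    rw [show b * (x : ℂ) ^ 2 + (c + u) * x + d = ((u * x : ℝ) : ℂ) + (b * x ^ 2 + c * x + d) by
      push_cast; ring, Complex.exp_add, norm_mul, ← Complex.ofReal_exp, Complex.norm_real,
      Real.norm_of_nonneg (Real.exp_pos _).le]
  have h6 := h5 1
  have h7 := h5 (-1)
  simp only [Complex.ofReal_one, Complex.ofReal_neg, one_mul, neg_mul, ← sub_eq_add_neg] at h6 h7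
  simp only [Pi.add_apply, h6, h7]
  rw [norm_mul]
  calc _ ≤ (‖p‖ + ‖q‖) * (Real.exp x + Real.exp (-x)) *
        ‖Complex.exp (b * x ^ 2 + c * x + d)‖ := by
        gcongr
        exact h1.trans (by gcongr)
    _ = _ := by ring

theorem hasDerivAt_cexp_quadratic (b c d : ℂ) (x : ℝ) :
    HasDerivAt (fun x : ℝ => Complex.exp (b * x ^ 2 + c * x + d))
      ((2 * b * x + c) * Complex.exp (b * x ^ 2 + c * x + d)) x := by
  have h1 : HasDerivAt (fun x : ℝ => (x : ℂ)) 1 x := Complex.ofRealCLM.hasDerivAt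
  have h := ((((h1.pow 2).const_mul b).add (h1.const_mul c)).add_const d).cexp
  simp only [Pi.pow_apply, Pi.add_apply] at h
  convert h using 1
  push_cast
  ring

theorem integral_deriv_cexp_quadratic {b : ℂ} (hb : b.re < 0) (c d : ℂ) :
    ∫ x : ℝ, (2 * b * x + c) * Complex.exp (b * x ^ 2 + c * x + d) = 0 :=
  integral_eq_zero_of_hasDerivAt_of_integrable (hasDerivAt_cexp_quadratic b c d)
    (integrable_linear_mul_cexp_quadratic hb c d (2 * b) c) (integrable_cexp_quadratic' hb c d)

/-- The value of the standard Gaussian integral `∫ exp (-x ^ 2 / 2)`. -/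
noncomputable def gaussMass : ℂ := (Real.pi / -(-1 / 2 : ℂ)) ^ (1 / 2 : ℂ)

theorem gaussMass_ne_zero : gaussMass ≠ 0 := by
  have : (Real.pi : ℂ) ≠ 0 := by exact_mod_cast Real.pi_ne_zero
  simp [gaussMass, Complex.cpow_eq_zero_iff, this]

theorem neg_half_re_neg : (-1 / 2 : ℂ).re < 0 := by norm_num

theorem integral_cexp_neg_half_quadratic (c d : ℂ) :
    ∫ x : ℝ, Complex.exp (-1 / 2 * x ^ 2 + c * x + d) =
      gaussMass * Complex.exp (d + c ^ 2 / 2) := by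
  rw [integral_cexp_quadratic neg_half_re_neg, gaussMass]
  ring_nf

/-- A Gaussian in `y` centred at `L`, twisted by the character `y ↦ exp (-i t y)`. -/
noncomputable def gaussKernel (L t y : ℝ) : ℂ :=
  Complex.exp (-1 / 2 * y ^ 2 + (L - Complex.I * t) * y + -L ^ 2 / 2)

theorem gaussKernel_eq (L t y : ℝ) : gaussKernel L t y =
    Real.exp (-(y - L) ^ 2 / 2) * Complex.exp (-(Complex.I * t * y)) := by
  rw [gaussKernel, Complex.ofReal_exp, ← Complex.exp_add]
  congr 1
  push_cast
  ring

theorem norm_gaussKernel (L t y : ℝ) : ‖gaussKernel L t y‖ = Real.exp (-(y - L) ^ 2 / 2) := by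
  rw [gaussKernel_eq, norm_mul, Complex.norm_real, Complex.norm_exp,
    Real.norm_of_nonneg (Real.exp_pos _).le]
  simp

/-- The derivative of `gaussKernel L t`. -/
noncomputable def gaussKernelDeriv (L t y : ℝ) : ℂ :=
  (2 * (-1 / 2) * y + (L - Complex.I * t)) * gaussKernel L t y

theorem hasDerivAt_gaussKernel (L t y : ℝ) :
    HasDerivAt (gaussKernel L t) (gaussKernelDeriv L t y) y :=
  hasDerivAt_cexp_quadratic _ _ _ y

theorem continuous_gaussKernelDeriv (L t : ℝ) : Continuous (gaussKernelDeriv L t) := by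
  unfold gaussKernelDeriv gaussKernel
  fun_prop

theorem tendsto_gaussKernel (L t : ℝ) : Tendsto (gaussKernel L t) atTop (𝓝 0) := by
  rw [tendsto_zero_iff_norm_tendsto_zero]
  simp only [norm_gaussKernel]
  refine Real.tendsto_exp_atBot.comp ?_
  simp only [neg_div]
  refine tendsto_neg_atTop_atBot.comp (Tendsto.atTop_div_const two_pos ?_)
  exact (tendsto_pow_atTop two_ne_zero).comp (tendsto_atTop_add_const_right _ (-L) tendsto_id)

theorem integrable_gaussKernelDeriv_mul_exp (L t : ℝ) :
    Integrable fun y : ℝ => gaussKernelDeriv L t y * (Real.exp y : ℂ) := by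
  refine (integrable_linear_mul_cexp_quadratic neg_half_re_neg (L - Complex.I * t + 1)
    (-L ^ 2 / 2) (2 * (-1 / 2)) (L - Complex.I * t)).congr (Eventually.of_forall fun y => ?_)
  simp only [gaussKernelDeriv, gaussKernel, Complex.ofReal_exp, mul_assoc]
  rw [← Complex.exp_add]
  ring_nf

theorem norm_integral_gaussKernelDeriv_mul_exp (L t : ℝ) :
    ‖∫ y : ℝ, gaussKernelDeriv L t y * (Real.exp y : ℂ)‖ =
      ‖gaussMass‖ * Real.exp (1 / 2) * (Real.exp L * Real.exp (-t ^ 2 / 2)) := by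
  set c : ℂ := L - Complex.I * t + 1 with hc
  set d : ℂ := -L ^ 2 / 2 with hd
  have h1 : (fun y : ℝ => gaussKernelDeriv L t y * (Real.exp y : ℂ)) = fun y : ℝ =>
      (2 * (-1 / 2) * y + c) * Complex.exp (-1 / 2 * y ^ 2 + c * y + d) -
        Complex.exp (-1 / 2 * y ^ 2 + c * y + d) := by
    ext y
    rw [gaussKernelDeriv, gaussKernel, Complex.ofReal_exp, mul_assoc, ← Complex.exp_add, hc, hd]
    ring_nf
  rw [h1, integral_sub (integrable_linear_mul_cexp_quadratic neg_half_re_neg _ _ _ _)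
    (integrable_cexp_quadratic' neg_half_re_neg _ _), integral_deriv_cexp_quadratic
    neg_half_re_neg, integral_cexp_neg_half_quadratic, zero_sub, norm_neg, norm_mul,
    Complex.norm_exp, mul_assoc, ← Real.exp_add, ← Real.exp_add]
  congr 2
  simp [hc, hd, pow_two]
  ring

/-- The Mellin weight whose inverse transform is `gaussKernel`. -/
noncomputable def gaussWeight (σ L v : ℝ) : ℂ :=
  Complex.exp (-1 / 2 * v ^ 2 + (Complex.I * σ + Complex.I * L) * v + (σ ^ 2 / 2 + σ * L))

theorem norm_gaussWeight (σ L v : ℝ) : ‖gaussWeight σ L v‖ =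
    Real.exp (σ ^ 2 / 2) * (Real.exp (σ * L) * Real.exp (-v ^ 2 / 2)) := by
  rw [gaussWeight, Complex.norm_exp, ← Real.exp_add, ← Real.exp_add]
  congr 1
  simp [pow_two]
  ring

theorem integral_gaussWeight (σ L t y : ℝ) :
    ∫ v : ℝ, (σ + Complex.I * (v + t : ℝ)) * gaussWeight σ L v *
      Complex.exp (-(σ + Complex.I * (v + t : ℝ)) * y) = -gaussMass * gaussKernelDeriv L t y := by
  set c : ℂ := Complex.I * σ + Complex.I * (L - y) with hc
  set d : ℂ := σ ^ 2 / 2 + σ * (L - y) - Complex.I * t * y with hd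
  have h1 : (fun v : ℝ => (σ + Complex.I * (v + t : ℝ)) * gaussWeight σ L v *
      Complex.exp (-(σ + Complex.I * (v + t : ℝ)) * y)) = fun v : ℝ =>
      -Complex.I * ((2 * (-1 / 2) * v + c) * Complex.exp (-1 / 2 * v ^ 2 + c * v + d)) +
        (y - L + Complex.I * t) * Complex.exp (-1 / 2 * v ^ 2 + c * v + d) := by
    ext v
    have h2 : gaussWeight σ L v * Complex.exp (-(σ + Complex.I * (v + t : ℝ)) * y) =
        Complex.exp (-1 / 2 * v ^ 2 + c * v + d) := by
      rw [gaussWeight, ← Complex.exp_add, hc, hd]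
      push_cast
      ring_nf
    rw [mul_assoc, h2]
    generalize Complex.exp (-1 / 2 * v ^ 2 + c * v + d) = e
    rw [hc]
    push_cast
    linear_combination ((σ + L - y) * e) * Complex.I_sq
  rw [h1, integral_add ((integrable_linear_mul_cexp_quadratic neg_half_re_neg _ _ _ _).const_mul _)
    ((integrable_cexp_quadratic' neg_half_re_neg _ _).const_mul _), integral_const_mul,
    integral_const_mul, integral_deriv_cexp_quadratic neg_half_re_neg,
    integral_cexp_neg_half_quadratic, gaussKernelDeriv, gaussKernel]
  have h3 : d + c ^ 2 / 2 = -1 / 2 * y ^ 2 + (L - Complex.I * t) * y + -L ^ 2 / 2 := by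
    rw [hc, hd]
    linear_combination ((σ + L - y : ℂ) ^ 2 / 2) * Complex.I_sq
  rw [h3]
  ring

theorem integrable_mul_gaussWeight (σ L t : ℝ) :
    Integrable fun v : ℝ => (σ + Complex.I * (v + t : ℝ)) * gaussWeight σ L v := by
  refine (integrable_linear_mul_cexp_quadratic neg_half_re_neg
    (Complex.I * σ + Complex.I * L) (σ ^ 2 / 2 + σ * L) Complex.I (σ + Complex.I * t)).congr
    (Eventually.of_forall fun v => ?_)
  simp only [gaussWeight]
  push_cast
  ring

end Gaussian

namespace BeurlingSystem

variable {S : BeurlingSystem}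

theorem integrable_gaussWeight_mul_discrepancy (hfin : ∀ x, {j : ℕ | S.n j ≤ x}.Finite)
    {θ A C : ℝ} (hC : ∀ y, 0 ≤ y → |S.discrepancy A y| ≤ C * Real.exp (θ * y)) {σ : ℝ}
    (hσ0 : θ < σ) (hσ1 : σ < 1) (L t : ℝ) :
    Integrable (fun q : ℝ × ℝ => (σ + Complex.I * (q.2 + t : ℝ)) * gaussWeight σ L q.2 *
      Complex.exp (-(σ + Complex.I * (q.2 + t : ℝ)) * q.1) * (S.discrepancy A q.1 : ℂ))
      (volume.prod volume) := by
  have h1 := integrable_discrepancy_mul_exp hfin hC (s := σ) (by simpa) (by simpa)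
  have h2 := h1.mul_prod (integrable_mul_gaussWeight σ L t)
  have h3 : (fun q : ℝ × ℝ => (σ + Complex.I * (q.2 + t : ℝ)) * gaussWeight σ L q.2 *
      Complex.exp (-(σ + Complex.I * (q.2 + t : ℝ)) * q.1) * (S.discrepancy A q.1 : ℂ)) =
      fun q : ℝ × ℝ => Complex.exp (-(Complex.I * (q.2 + t : ℝ)) * q.1) *
        ((S.discrepancy A q.1 : ℂ) * Complex.exp (-σ * q.1) *
          ((σ + Complex.I * (q.2 + t : ℝ)) * gaussWeight σ L q.2)) := by
    ext q
    rw [neg_add, add_mul (-(σ : ℂ)), Complex.exp_add]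
    ring
  rw [h3]
  refine h2.bdd_mul (c := 1) ?_ (Eventually.of_forall fun q => ?_)
  · exact (by fun_prop : Continuous fun q : ℝ × ℝ =>
      Complex.exp (-(Complex.I * (q.2 + t : ℝ)) * q.1)).aestronglyMeasurable
  · rw [Complex.norm_exp]
    simp

theorem integral_gaussKernelDeriv_mul_discrepancy (hfin : ∀ x, {j : ℕ | S.n j ≤ x}.Finite)
    {θ A C : ℝ} (hC : ∀ y, 0 ≤ y → |S.discrepancy A y| ≤ C * Real.exp (θ * y)) {Z : ℂ → ℂ}
    (hZ : S.IsZeta θ A Z) {σ : ℝ} (hσ0 : θ < σ) (hσ1 : σ < 1) (L t : ℝ) :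
    Integrable (fun y => gaussKernelDeriv L t y * (S.discrepancy A y : ℂ)) ∧
    -gaussMass * ∫ y, gaussKernelDeriv L t y * (S.discrepancy A y : ℂ) =
      ∫ v : ℝ, gaussWeight σ L v * Z (σ + Complex.I * (v + t : ℝ)) := by
  have hi := integrable_gaussWeight_mul_discrepancy hfin hC hσ0 hσ1 L t
  have h1 : ∀ y : ℝ, ∫ v : ℝ, (σ + Complex.I * (v + t : ℝ)) * gaussWeight σ L v *
      Complex.exp (-(σ + Complex.I * (v + t : ℝ)) * y) * (S.discrepancy A y : ℂ) =
      -gaussMass * (gaussKernelDeriv L t y * (S.discrepancy A y : ℂ)) := fun y => by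
    rw [integral_mul_const, integral_gaussWeight, mul_assoc]
  have h2 := hi.integral_prod_left
  simp only [h1] at h2
  refine ⟨(integrable_const_mul_iff (neg_ne_zero.2 gaussMass_ne_zero).isUnit _).1 h2, ?_⟩
  rw [← integral_const_mul]
  simp_rw [← h1]
  rw [integral_integral_swap hi]
  refine integral_congr_ae (Eventually.of_forall fun v => ?_)
  have hre : (σ + Complex.I * (v + t : ℝ) : ℂ).re = σ := by simp
  simp only
  rw [hZ.eq_mul_integral hfin (hσ0.trans hσ1) hC (by rwa [hre]) (by rwa [hre])]
  simp_rw [← integral_const_mul]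
  congr 1
  ext y
  ring

theorem exists_hasSum_gaussKernel (hfin : ∀ x, {j : ℕ | S.n j ≤ x}.Finite) {θ A C : ℝ}
    (hA : 0 ≤ A) (hC : ∀ y, 0 ≤ y → |S.discrepancy A y| ≤ C * Real.exp (θ * y)) {Z : ℂ → ℂ}
    (hZ : S.IsZeta θ A Z) {σ : ℝ} (hσ0 : θ < σ) (hσ1 : σ < 1) :
    ∃ K : ℝ, 0 ≤ K ∧ ∀ L t : ℝ, ∃ h : ℂ,
      HasSum (fun j => gaussKernel L t (Real.log (S.n j))) h ∧
      ‖h‖ ≤ K * (Real.exp L * Real.exp (-t ^ 2 / 2) + Real.exp (σ * L) *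
        ∫ v : ℝ, Real.exp (-v ^ 2 / 2) * ‖Z (σ + Complex.I * (v + t : ℝ))‖) := by
  have hm : 0 < ‖gaussMass‖ := norm_pos_iff.2 gaussMass_ne_zero
  set K₁ := A * (‖gaussMass‖ * Real.exp (1 / 2)) with hK₁
  set K₂ := ‖gaussMass‖⁻¹ * Real.exp (σ ^ 2 / 2) with hK₂
  have hK₁0 : 0 ≤ K₁ := by positivity
  have hK₂0 : 0 ≤ K₂ := by positivity
  refine ⟨K₁ + K₂, by positivity, fun L t => ?_⟩
  obtain ⟨hi, heq⟩ := integral_gaussKernelDeriv_mul_discrepancy hfin hC hZ hσ0 hσ1 L t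
  have hi' := (integrable_gaussKernelDeriv_mul_exp L t).const_mul (A : ℂ)
  have hsplit : (fun y => gaussKernelDeriv L t y * (S.Nint (Real.exp y) : ℂ)) = fun y =>
      gaussKernelDeriv L t y * (S.discrepancy A y : ℂ) +
        A * (gaussKernelDeriv L t y * (Real.exp y : ℂ)) := by
    ext y
    rw [discrepancy]
    push_cast
    ring
  refine ⟨-∫ y, gaussKernelDeriv L t y * (S.Nint (Real.exp y) : ℂ), ?_, ?_⟩
  · exact hasSum_comp_log_n hfin (hasDerivAt_gaussKernel L t) (continuous_gaussKernelDeriv L t)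
      (tendsto_gaussKernel L t) (hsplit ▸ hi.add hi')
  · set J := ∫ v : ℝ, Real.exp (-v ^ 2 / 2) * ‖Z (σ + Complex.I * (v + t : ℝ))‖ with hJ
    have hJ0 : 0 ≤ J := integral_nonneg fun v => by positivity
    have h1 : ‖∫ y, gaussKernelDeriv L t y * (S.discrepancy A y : ℂ)‖ ≤
        K₂ * (Real.exp (σ * L) * J) := by
      have h2 : ‖gaussMass‖ * ‖∫ y, gaussKernelDeriv L t y * (S.discrepancy A y : ℂ)‖ ≤
          Real.exp (σ ^ 2 / 2) * (Real.exp (σ * L) * J) := by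
        rw [← norm_neg gaussMass, ← norm_mul, heq]
        refine (norm_integral_le_integral_norm _).trans (le_of_eq ?_)
        simp_rw [hJ, ← integral_const_mul, norm_mul, norm_gaussWeight, mul_assoc]
      rw [hK₂, mul_assoc, inv_mul_eq_div, le_div_iff₀ hm, mul_comm]
      exact h2
    rw [norm_neg, hsplit, integral_add hi hi', integral_const_mul]
    refine (norm_add_le _ _).trans ?_
    rw [norm_mul, norm_integral_gaussKernelDeriv_mul_exp, Complex.norm_real,
      Real.norm_of_nonneg hA, ← mul_assoc A, ← hK₁]
    have h3 : 0 ≤ Real.exp L * Real.exp (-t ^ 2 / 2) := by positivity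
    have h4 : 0 ≤ Real.exp (σ * L) * J := by positivity
    nlinarith [mul_nonneg hK₁0 h4, mul_nonneg hK₂0 h3]

/-- Linear growth of the zeta function on vertical lines in the strip `θ < σ < 1`. -/
theorem IsZeta.exists_norm_le (hfin : ∀ x, {j : ℕ | S.n j ≤ x}.Finite) {θ A C : ℝ}
    (hC : ∀ y, 0 ≤ y → |S.discrepancy A y| ≤ C * Real.exp (θ * y)) {Z : ℂ → ℂ}
    (hZ : S.IsZeta θ A Z) {σ : ℝ} (hσ0 : θ < σ) (hσ1 : σ < 1) :
    ∃ B : ℝ, 0 ≤ B ∧ ∀ v : ℝ, ‖Z (σ + Complex.I * (v : ℝ))‖ ≤ B * Real.exp |v| := by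
  set I := ∫ y : ℝ, ‖(S.discrepancy A y : ℂ) * Complex.exp (-(σ : ℂ) * y)‖ with hI
  have hI0 : 0 ≤ I := integral_nonneg fun _ => norm_nonneg _
  refine ⟨(|σ| + 1) * I, by positivity, fun v => ?_⟩
  have hre : (σ + Complex.I * v : ℂ).re = σ := by simp
  rw [hZ.eq_mul_integral hfin (hσ0.trans hσ1) hC (by rwa [hre]) (by rwa [hre]), norm_mul]
  have h1 : ‖(σ + Complex.I * v : ℂ)‖ ≤ (|σ| + 1) * Real.exp |v| := by
    refine (norm_add_le _ _).trans ?_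
    rw [norm_mul, Complex.norm_I, Complex.norm_real, Complex.norm_real, Real.norm_eq_abs,
      Real.norm_eq_abs]
    have h2 := Real.add_one_le_exp |v|
    nlinarith [abs_nonneg v, abs_nonneg σ]
  have h2 : ‖∫ y : ℝ, (S.discrepancy A y : ℂ) * Complex.exp (-(σ + Complex.I * v) * y)‖ ≤ I := by
    refine (norm_integral_le_integral_norm _).trans (le_of_eq ?_)
    simp [hI, Complex.norm_exp]
  calc _ ≤ (|σ| + 1) * Real.exp |v| * I := by gcongr
    _ = _ := by ring

theorem IsZeta.continuous_line {θ A : ℝ} {Z : ℂ → ℂ} (hZ : S.IsZeta θ A Z) {σ : ℝ}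
    (hσ0 : θ < σ) (hσ1 : σ < 1) : Continuous fun v : ℝ => Z (σ + Complex.I * (v : ℝ)) := by
  have h1 : Continuous fun v : ℝ => (Z (σ + Complex.I * v) - A / ((σ + Complex.I * v : ℂ) - 1)) :=
    hZ.2.continuousOn.comp_continuous (by fun_prop) fun v => by simpa using hσ0
  have h2 : Continuous fun v : ℝ => (A : ℂ) / ((σ + Complex.I * v : ℂ) - 1) := by
    refine continuous_const.div (by fun_prop) fun v h => ?_
    have := congrArg Complex.re h
    simp at this
    linarith
  exact (h1.add h2).congr fun v => sub_add_cancel _ _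

end BeurlingSystem

section LargeValues

theorem large_sieve_of_gram_bound {ι κ : Type*} [Fintype κ] (J : Finset ι) {w : ι → ℝ}
    (hw : ∀ j, 0 ≤ w j) {w₀ : ℝ} (hw₀0 : 0 ≤ w₀) (hw₀ : ∀ j ∈ J, w₀ ≤ w j) (e : κ → ι → ℂ)
    {H : κ → κ → ℂ} (hH : ∀ r s, HasSum (fun j => (w j : ℂ) * (e r j * star (e s j))) (H r s))
    {M : ℝ} (hM : 0 ≤ M) (hrow : ∀ r, ∑ s, ‖H r s‖ ≤ M) (hcol : ∀ s, ∑ r, ‖H r s‖ ≤ M) (a : ι → ℂ) :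
    w₀ * ∑ r, ‖∑ j ∈ J, a j * e r j‖ ^ 2 ≤ M * ∑ j ∈ J, ‖a j‖ ^ 2 := by
  set c : κ → ℂ := fun r => ∑ j ∈ J, a j * e r j with hc
  set X := ∑ r, ‖c r‖ ^ 2 with hX
  set b : ι → ℂ := fun j => ∑ r, star (c r) * e r j with hb
  have hX0 : 0 ≤ X := Finset.sum_nonneg fun _ _ => sq_nonneg _
  have hdual : X ≤ ∑ j ∈ J, ‖a j‖ * ‖b j‖ := by
    have h1 : (X : ℂ) = ∑ j ∈ J, a j * b j := by
      rw [hX, hb]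
      push_cast
      simp_rw [Finset.mul_sum]
      rw [Finset.sum_comm]
      refine Finset.sum_congr rfl fun r _ => ?_
      rw [← Complex.mul_conj']
      conv_lhs => rw [hc]
      rw [Finset.sum_mul]
      refine Finset.sum_congr rfl fun j _ => ?_
      rw [Complex.star_def]
      ring
    calc X = ‖(X : ℂ)‖ := by rw [Complex.norm_real, Real.norm_of_nonneg hX0]
      _ ≤ ∑ j ∈ J, ‖a j * b j‖ := h1 ▸ norm_sum_le _ _
      _ = _ := by simp_rw [norm_mul]
  have hgram : HasSum (fun j => ((w j * ‖b j‖ ^ 2 : ℝ) : ℂ))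
      (∑ r, ∑ s, star (c r) * c s * H r s) := by
    have h := hasSum_sum fun r (_ : r ∈ Finset.univ) => hasSum_sum
      fun s (_ : s ∈ Finset.univ) => (hH r s).mul_left (star (c r) * c s)
    refine (congrArg (fun f => HasSum f _) (funext fun j => ?_)).mpr h
    push_cast
    rw [← Complex.mul_conj', hb]
    simp_rw [map_sum, Finset.sum_mul_sum, Finset.mul_sum]
    refine Finset.sum_congr rfl fun r _ => Finset.sum_congr rfl fun s _ => ?_
    simp only [Complex.star_def, map_mul, Complex.conj_conj]
    ring
  have hre := Complex.hasSum_re hgram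
  simp only [Complex.ofReal_re] at hre
  have hbound : (∑ r, ∑ s, star (c r) * c s * H r s).re ≤ M * X := by
    calc _ ≤ ‖∑ r, ∑ s, star (c r) * c s * H r s‖ := Complex.re_le_norm _
      _ ≤ ∑ r, ∑ s, ‖star (c r) * c s * H r s‖ :=
        (norm_sum_le _ _).trans (Finset.sum_le_sum fun _ _ => norm_sum_le _ _)
      _ ≤ ∑ r, ∑ s, (‖c r‖ ^ 2 / 2 * ‖H r s‖ + ‖c s‖ ^ 2 / 2 * ‖H r s‖) := by
        gcongr with r _ s _
        rw [norm_mul, norm_mul, norm_star, ← add_mul]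
        gcongr
        nlinarith [sq_nonneg (‖c r‖ - ‖c s‖)]
      _ = ∑ r, ‖c r‖ ^ 2 / 2 * ∑ s, ‖H r s‖ + ∑ s, ‖c s‖ ^ 2 / 2 * ∑ r, ‖H r s‖ := by
        simp_rw [Finset.sum_add_distrib, Finset.mul_sum]
        congr 1
        exact Finset.sum_comm
      _ ≤ ∑ r, ‖c r‖ ^ 2 / 2 * M + ∑ s, ‖c s‖ ^ 2 / 2 * M := by
        gcongr with r _ s _
        · exact hrow r
        · exact hcol s
      _ = M * X := by
        rw [← Finset.sum_mul, ← Finset.sum_div, ← hX]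
        ring
  have hB : w₀ * ∑ j ∈ J, ‖b j‖ ^ 2 ≤ M * X := by
    rw [Finset.mul_sum]
    calc _ ≤ ∑ j ∈ J, w j * ‖b j‖ ^ 2 := by
          gcongr with j hj
          exact hw₀ j hj
      _ ≤ _ := sum_le_hasSum _ (fun j _ => mul_nonneg (hw j) (sq_nonneg _)) hre
      _ ≤ M * X := hbound
  have hcs := Finset.sum_mul_sq_le_sq_mul_sq J (fun j => ‖a j‖) fun j => ‖b j‖
  rcases hX0.eq_or_lt with h0 | h0
  · rw [← h0, mul_zero]
    positivity
  · refine le_of_mul_le_mul_right ?_ h0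
    calc w₀ * X * X = w₀ * X ^ 2 := by ring
      _ ≤ w₀ * ((∑ j ∈ J, ‖a j‖ ^ 2) * ∑ j ∈ J, ‖b j‖ ^ 2) := by
        gcongr
        exact (pow_le_pow_left₀ hX0 hdual 2).trans hcs
      _ = (∑ j ∈ J, ‖a j‖ ^ 2) * (w₀ * ∑ j ∈ J, ‖b j‖ ^ 2) := by ring
      _ ≤ (∑ j ∈ J, ‖a j‖ ^ 2) * (M * X) := by gcongr
      _ = _ := by ring

theorem summable_exp_neg_abs_int : Summable fun m : ℤ => Real.exp (-|(m : ℝ)|) := by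
  have h := Real.summable_exp_neg_nat
  refine Summable.of_nat_of_neg ?_ ?_ <;> simpa using h

theorem exists_sum_exp_le_of_wellSpaced : ∃ K : ℝ, 0 ≤ K ∧ ∀ (R : ℕ) (x : Fin R → ℝ),
    (∀ r s, r ≠ s → 1 ≤ |x r - x s|) → ∀ u : ℝ, ∑ s, Real.exp (-(u - x s) ^ 2 / 4) ≤ K := by
  refine ⟨Real.exp 2 * ∑' m : ℤ, Real.exp (-|(m : ℝ)|), ?_, fun R x hx u => ?_⟩
  · exact mul_nonneg (Real.exp_pos _).le (tsum_nonneg fun _ => (Real.exp_pos _).le)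
  have hinj : Function.Injective fun s => ⌊x s - u⌋ := by
    intro r s hrs
    by_contra hne
    have h1 := Int.abs_sub_lt_one_of_floor_eq_floor hrs
    have h2 := hx r s hne
    rw [sub_sub_sub_cancel_right] at h1
    linarith
  calc ∑ s, Real.exp (-(u - x s) ^ 2 / 4)
      ≤ ∑ s, Real.exp 2 * Real.exp (-|(⌊x s - u⌋ : ℝ)|) := by
        gcongr with s
        rw [← Real.exp_add]
        gcongr
        have h1 := Int.floor_le (x s - u)
        have h2 := Int.lt_floor_add_one (x s - u)
        rcases abs_cases (⌊x s - u⌋ : ℝ) with ⟨h, -⟩ | ⟨h, -⟩ <;> rw [h]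
        · nlinarith [sq_nonneg (x s - u - 2)]
        · nlinarith [sq_nonneg (x s - u + 2)]
    _ = Real.exp 2 * ∑ m ∈ Finset.univ.image fun s => ⌊x s - u⌋, Real.exp (-|(m : ℝ)|) := by
        rw [Finset.sum_image fun _ _ _ _ h => hinj h, Finset.mul_sum]
    _ ≤ _ := by
        gcongr
        exact summable_exp_neg_abs_int.sum_le_tsum _ fun _ _ => (Real.exp_pos _).le

theorem integrable_exp_neg_sq_mul {f : ℝ → ℝ} (hf : Continuous f) {B a : ℝ}
    (hB : ∀ u, |f u| ≤ B * Real.exp (a * |u|)) {β : ℝ} (hβ : 0 < β) (x : ℝ) :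
    Integrable fun u => Real.exp (-β * (u - x) ^ 2) * f u := by
  have hB0 : 0 ≤ B := by simpa using (abs_nonneg _).trans (hB 0)
  refine Integrable.mono' ((integrable_exp_neg_mul_sq (half_pos hβ)).const_mul
    (B * Real.exp (3 * β * x ^ 2 + a ^ 2 / β))) (by fun_prop) (Eventually.of_forall fun u => ?_)
  rw [norm_mul, Real.norm_of_nonneg (Real.exp_pos _).le, Real.norm_eq_abs]
  calc _ ≤ Real.exp (-β * (u - x) ^ 2) * (B * Real.exp (a * |u|)) := by gcongr; exact hB u
    _ = B * Real.exp (-β * (u - x) ^ 2 + a * |u|) := by rw [Real.exp_add]; ring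
    _ ≤ B * Real.exp (3 * β * x ^ 2 + a ^ 2 / β + -(β / 2) * u ^ 2) := by
      refine mul_le_mul_of_nonneg_left (Real.exp_le_exp.2 ?_) hB0
      have h1 : a * |u| ≤ β * u ^ 2 / 4 + a ^ 2 / β := by
        rw [← sq_abs u]
        have : β * |u| ^ 2 / 4 + a ^ 2 / β - a * |u| = (β * |u| / 2 - a) ^ 2 / β := by
          field_simp
          ring
        have : 0 ≤ (β * |u| / 2 - a) ^ 2 / β := by positivity
        linarith
      nlinarith [mul_nonneg hβ.le (sq_nonneg (u / 2 - 2 * x))]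
    _ = _ := by rw [Real.exp_add]; ring

theorem le_add_rpow_mul_rpow {p : ℝ} (hp : 1 ≤ p) {x l : ℝ} (hx : 0 ≤ x) (hl : 0 < l) :
    x ≤ l + l ^ (1 - p) * x ^ p := by
  rcases le_total x l with h | h
  · have : 0 ≤ l ^ (1 - p) * x ^ p := by positivity
    linarith
  · have hx0 := hl.trans_le h
    have h1 : x ^ (1 - p) ≤ l ^ (1 - p) := Real.rpow_le_rpow_of_nonpos hl h (by linarith)
    have h2 : x ^ (1 - p) * x ^ p = x := by rw [← Real.rpow_add hx0]; simp
    have h3 : x ^ (1 - p) * x ^ p ≤ l ^ (1 - p) * x ^ p := by gcongr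
    linarith

theorem sum_exp_half_le_indicator_add {K : ℝ} {R : ℕ} {x : Fin R → ℝ}
    (hK : ∀ u : ℝ, ∑ s, Real.exp (-(u - x s) ^ 2 / 4) ≤ K) {T : ℝ} (hxT : ∀ s, |x s| ≤ T)
    (u : ℝ) : ∑ s, Real.exp (-(1 / 2) * (u - x s) ^ 2) ≤
      K * ((Ioc (-(2 * T)) (2 * T)).indicator (fun _ => 1) u + Real.exp (-(1 / 16) * (u - 0) ^ 2)) := by
  have hK0 : 0 ≤ K := (Finset.sum_nonneg fun _ _ => (Real.exp_pos _).le).trans (hK 0)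
  by_cases hu : u ∈ Ioc (-(2 * T)) (2 * T)
  · rw [indicator_of_mem hu]
    calc _ ≤ ∑ s, Real.exp (-(u - x s) ^ 2 / 4) := by
          gcongr with s
          linarith [sq_nonneg (u - x s)]
      _ ≤ K * 1 := by rw [mul_one]; exact hK u
      _ ≤ _ := by gcongr; linarith [Real.exp_pos (-(1 / 16) * (u - 0) ^ 2)]
  · rw [indicator_of_notMem hu, zero_add]
    have hu' : 2 * T ≤ |u| := by
      by_contra! h
      exact hu ⟨(abs_lt.1 h).1, (abs_lt.1 h).2.le⟩
    calc _ ≤ ∑ s, Real.exp (-(u - x s) ^ 2 / 4) * Real.exp (-(1 / 16) * (u - 0) ^ 2) := by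
          gcongr with s
          rw [← Real.exp_add]
          gcongr
          have h1 : |u| / 2 ≤ |u - x s| := by
            linarith [abs_sub_abs_le_abs_sub u (x s), hxT s]
          have h2 : (|u| / 2) ^ 2 ≤ |u - x s| ^ 2 := by gcongr
          rw [div_pow, sq_abs, sq_abs] at h2
          linarith
      _ ≤ _ := by rw [← Finset.sum_mul]; gcongr; exact hK u

theorem exists_sum_integral_le_of_moment {g : ℝ → ℝ} (hg : Continuous g) (hg0 : ∀ u, 0 ≤ g u)
    {B : ℝ} (hB : ∀ u, g u ≤ B * Real.exp |u|) {p c : ℝ} (hp : 1 ≤ p) (hc : 0 ≤ c) {Ck : ℝ}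
    (hmom : ∀ T : ℝ, 2 ≤ T → (1 / T) * (∫ v in (-T)..T, g v ^ p) ≤ Ck * Real.log T ^ c) :
    ∃ C : ℝ, 0 ≤ C ∧ ∀ (T : ℝ) (R : ℕ) (x : Fin R → ℝ), 2 ≤ T → (∀ s, |x s| ≤ T) →
      (∀ r s, r ≠ s → 1 ≤ |x r - x s|) →
      ∑ s, ∫ v : ℝ, Real.exp (-v ^ 2 / 2) * g (v + x s) ≤
        C * (T ^ (1 / p) * (R : ℝ) ^ ((p - 1) / p) * Real.log T ^ (c / p)) := by
  obtain ⟨K, hK0, hK⟩ := exists_sum_exp_le_of_wellSpaced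
  have hp0 : 0 < p := one_pos.trans_le hp
  have hB0 : 0 ≤ B := by simpa using (hg0 0).trans (hB 0)
  have hqc : Continuous fun u => g u ^ p := hg.rpow_const fun _ => Or.inr hp0.le
  have hq0 : ∀ u, 0 ≤ g u ^ p := fun u => Real.rpow_nonneg (hg0 u) p
  have hqB : ∀ u, |g u ^ p| ≤ B ^ p * Real.exp (p * |u|) := fun u => by
    rw [abs_of_nonneg (hq0 u), mul_comm p, Real.exp_mul, ← Real.mul_rpow hB0 (Real.exp_pos _).le]
    exact Real.rpow_le_rpow (hg0 u) (hB u) hp0.le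
  have hgi : ∀ x, Integrable fun u => Real.exp (-(1 / 2) * (u - x) ^ 2) * g u := fun x =>
    integrable_exp_neg_sq_mul hg (B := B) (a := 1)
      (fun u => by rw [abs_of_nonneg (hg0 u), one_mul]; exact hB u) (by norm_num) x
  have hqi : ∀ {β : ℝ}, 0 < β → ∀ x,
      Integrable fun u => Real.exp (-β * (u - x) ^ 2) * g u ^ p := fun hβ x =>
    integrable_exp_neg_sq_mul hqc hqB hβ x
  have h1i : ∀ x : ℝ, Integrable fun u => Real.exp (-(1 / 2) * (u - x) ^ 2) := fun x =>
    (integrable_exp_neg_mul_sq (by norm_num : (0 : ℝ) < 1 / 2)).comp_sub_right x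
  set C₀ := ∫ u, Real.exp (-(1 / 16) * (u - 0) ^ 2) * g u ^ p with hC₀
  have hC₀0 : 0 ≤ C₀ := integral_nonneg fun u => mul_nonneg (Real.exp_pos _).le (hq0 u)
  set W := ∫ u : ℝ, Real.exp (-(1 / 2) * u ^ 2) with hW
  have hW0 : 0 ≤ W := integral_nonneg fun u => (Real.exp_pos _).le
  have hl2 : 0 < Real.log 2 := Real.log_pos one_lt_two
  set P := K * (|Ck| * 2 * 2 ^ c + C₀ / (2 * Real.log 2 ^ c)) + 1 with hP
  have hP0 : 0 < P := by positivity
  refine ⟨P ^ (1 / p) * (W + 1), by positivity, fun T R x hT hxT hx => ?_⟩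
  have hT0 : 0 < T := by linarith
  have hlT : Real.log 2 ≤ Real.log T := Real.log_le_log two_pos hT
  have hlT0 : 0 < Real.log T := hl2.trans_le hlT
  set Y := T * Real.log T ^ c with hY
  have hY0 : 0 < Y := by positivity
  have hshift : ∀ s, ∫ v : ℝ, Real.exp (-v ^ 2 / 2) * g (v + x s) =
      ∫ u, Real.exp (-(1 / 2) * (u - x s) ^ 2) * g u := fun s => by
    rw [← integral_add_right_eq_self (fun u => Real.exp (-(1 / 2) * (u - x s) ^ 2) * g u) (x s)]
    congr 1
    ext v
    rw [add_sub_cancel_right]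
    ring_nf
  have hmom' : ∫ u in Ioc (-(2 * T)) (2 * T), g u ^ p ≤ |Ck| * 2 * 2 ^ c * Y := by
    rw [← intervalIntegral.integral_of_le (by linarith)]
    have h1 := hmom (2 * T) (by linarith)
    rw [one_div, inv_mul_le_iff₀ (by positivity)] at h1
    have h2 : Real.log (2 * T) ≤ 2 * Real.log T := by
      rw [Real.log_mul two_ne_zero hT0.ne']
      linarith
    have h3 : 0 ≤ Real.log (2 * T) := Real.log_nonneg (by linarith)
    calc _ ≤ 2 * T * (Ck * Real.log (2 * T) ^ c) := h1
      _ ≤ 2 * T * (|Ck| * (2 * Real.log T) ^ c) := by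
        gcongr
        exact le_abs_self _
      _ = _ := by rw [Real.mul_rpow two_pos.le hlT0.le, hY]; ring
  have hC₀Y : C₀ ≤ C₀ / (2 * Real.log 2 ^ c) * Y := by
    rw [div_mul_eq_mul_div, le_div_iff₀ (by positivity), hY]
    gcongr
  have hQ : ∑ s, ∫ u, Real.exp (-(1 / 2) * (u - x s) ^ 2) * g u ^ p ≤ P * Y := by
    rw [← integral_finsetSum _ fun s _ => hqi (by norm_num) (x s)]
    have hind : ∀ u, K * ((Ioc (-(2 * T)) (2 * T)).indicator (fun _ => 1) u +
        Real.exp (-(1 / 16) * (u - 0) ^ 2)) * g u ^ p =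
        K * ((Ioc (-(2 * T)) (2 * T)).indicator (fun u => g u ^ p) u +
          Real.exp (-(1 / 16) * (u - 0) ^ 2) * g u ^ p) := fun u => by
      by_cases hu : u ∈ Ioc (-(2 * T)) (2 * T)
      · simp only [indicator_of_mem hu]
        ring
      · simp only [indicator_of_notMem hu]
        ring
    have hi1 : Integrable ((Ioc (-(2 * T)) (2 * T)).indicator fun u => g u ^ p) :=
      (integrable_indicator_iff measurableSet_Ioc).2
        ((hqc.integrableOn_Icc).mono_set Ioc_subset_Icc_self)
    have hi2 := hqi (β := 1 / 16) (by norm_num) 0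
    calc _ ≤ ∫ u, K * ((Ioc (-(2 * T)) (2 * T)).indicator (fun u => g u ^ p) u +
          Real.exp (-(1 / 16) * (u - 0) ^ 2) * g u ^ p) := by
          refine integral_mono (integrable_finsetSum _ fun s _ => hqi (by norm_num) (x s))
            ((hi1.add hi2).const_mul K) fun u => ?_
          simp only
          rw [← Finset.sum_mul, ← hind]
          exact mul_le_mul_of_nonneg_right
            (sum_exp_half_le_indicator_add (hK R x hx) hxT u) (hq0 u)
      _ = K * ((∫ u in Ioc (-(2 * T)) (2 * T), g u ^ p) + C₀) := by
          rw [integral_const_mul, integral_add hi1 hi2, integral_indicator measurableSet_Ioc]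
      _ ≤ K * (|Ck| * 2 * 2 ^ c * Y + C₀ / (2 * Real.log 2 ^ c) * Y) := by gcongr
      _ ≤ P * Y := by rw [hP]; linarith
  rcases Nat.eq_zero_or_pos R with rfl | hR
  · simp only [Finset.univ_eq_empty, Finset.sum_empty]
    positivity
  have hR0 : (0 : ℝ) < R := by exact_mod_cast hR
  set l := (P * Y / R) ^ (1 / p) with hl
  have hl0 : 0 < l := by positivity
  have hmain : ∀ s, ∫ u, Real.exp (-(1 / 2) * (u - x s) ^ 2) * g u ≤
      l * W + l ^ (1 - p) * ∫ u, Real.exp (-(1 / 2) * (u - x s) ^ 2) * g u ^ p := fun s => by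
    calc _ ≤ ∫ u, (l * Real.exp (-(1 / 2) * (u - x s) ^ 2) +
          l ^ (1 - p) * (Real.exp (-(1 / 2) * (u - x s) ^ 2) * g u ^ p)) := by
          refine integral_mono (hgi _) (((h1i _).const_mul l).add
            ((hqi (by norm_num) _).const_mul _)) fun u => ?_
          have := mul_le_mul_of_nonneg_left (le_add_rpow_mul_rpow hp (hg0 u) hl0)
            (Real.exp_pos (-(1 / 2) * (u - x s) ^ 2)).le
          simp only
          linarith
      _ = _ := by
          rw [integral_add ((h1i _).const_mul l) ((hqi (by norm_num) _).const_mul _),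
            integral_const_mul, integral_const_mul,
            integral_sub_right_eq_self (fun u => Real.exp (-(1 / 2) * u ^ 2)) (x s)]
  have hlp : l ^ p = P * Y / R := by
    rw [hl, ← Real.rpow_mul (by positivity), one_div_mul_cancel hp0.ne', Real.rpow_one]
  have hlR : l * R = P ^ (1 / p) * (T ^ (1 / p) * (R : ℝ) ^ ((p - 1) / p) *
      Real.log T ^ (c / p)) := by
    have h1 : (R : ℝ) ^ ((p - 1) / p) = R / R ^ (1 / p) := by
      rw [sub_div, div_self hp0.ne', Real.rpow_sub hR0, Real.rpow_one]
    rw [hl, h1, Real.div_rpow (by positivity) hR0.le, Real.mul_rpow hP0.le hY0.le, hY,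
      Real.mul_rpow hT0.le (by positivity), ← Real.rpow_mul hlT0.le, mul_one_div]
    ring
  simp_rw [hshift]
  calc _ ≤ ∑ s, (l * W + l ^ (1 - p) * ∫ u, Real.exp (-(1 / 2) * (u - x s) ^ 2) * g u ^ p) :=
        Finset.sum_le_sum fun s _ => hmain s
    _ = l * R * W + l ^ (1 - p) * ∑ s, ∫ u, Real.exp (-(1 / 2) * (u - x s) ^ 2) * g u ^ p := by
        rw [Finset.sum_add_distrib, Finset.mul_sum, Finset.sum_const, Finset.card_univ,
          Fintype.card_fin, nsmul_eq_mul]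
        ring
    _ ≤ l * R * W + l ^ (1 - p) * (P * Y) := by gcongr
    _ = l * R * (W + 1) := by
        rw [show P * Y = l ^ p * R by rw [hlp]; field_simp, ← mul_assoc, ← Real.rpow_add hl0]
        simp
        ring
    _ = _ := by rw [hlR]; ring

end LargeValues

/-- Estimate (5.9): the Halász–Montgomery inequality for Beurling systems, conditional
on a `2k`-th moment bound of `ζ_𝒫` on the line `Re s = (1+θ)/2`. -/
theorem halasz_montgomery_moments
    (θ : ℝ) (hθ0 : 0 ≤ θ) (hθ1 : θ < 1) (S : BeurlingSystem)
    (A : ℝ) (hA : 0 < A)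
    (hwb : (fun x : ℝ => (S.Nint x : ℝ) - A * x) =O[atTop] fun x : ℝ => x ^ θ)
    (Z : ℂ → ℂ) (hZ : S.IsZeta θ A Z)
    (k : ℝ) (hk : 1 / 2 ≤ k) (c : ℝ) (hc : 0 < c)
    (hmom : ∃ Ck : ℝ, ∀ T : ℝ, 2 ≤ T →
      (1 / T) * (∫ v in (-T)..T,
          ‖Z ((((1 + θ) / 2 : ℝ) : ℂ) + Complex.I * (v : ℂ))‖ ^ (2 * k))
        ≤ Ck * Real.log T ^ c) :
    ∃ c' C : ℝ, ∀ (T N : ℝ) (R : ℕ) (t : Fin R → ℝ) (a : ℕ → ℂ),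
      2 ≤ T → 2 ≤ N →
      (∀ r, t r ∈ Set.Icc (0:ℝ) T) →
      (∀ r s : Fin R, r ≠ s → 1 ≤ |t r - t s|) →
      (∑ r : Fin R, ‖∑' j : ℕ, Set.indicator {j : ℕ | N < S.n j ∧ S.n j ≤ 2 * N}
          (fun j => a j * (S.n j : ℂ) ^ (-(Complex.I * ((t r : ℝ) : ℂ)))) j‖ ^ 2)
        ≤ C * (N + N ^ ((1 + θ) / 2) * T ^ (1 / (2 * k)) * (R : ℝ) ^ ((2 * k - 1) / (2 * k))
              * Real.log T ^ c') *
            ∑' j : ℕ, Set.indicator {j : ℕ | N < S.n j ∧ S.n j ≤ 2 * N}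
              (fun j => ‖a j‖ ^ 2) j := by
  obtain ⟨Ck, hCk⟩ := hmom
  have hfin := BeurlingSystem.finite_setOf_n_le hθ1 hA hwb
  obtain ⟨C, -, hC⟩ := BeurlingSystem.exists_abs_Nint_sub_le hθ0 hθ1 hA hwb
  have hD : ∀ y, 0 ≤ y → |S.discrepancy A y| ≤ C * Real.exp (θ * y) := fun y hy => by
    have := hC (Real.exp y) (Real.one_le_exp hy)
    rwa [← Real.exp_mul, mul_comm y] at this
  set σ : ℝ := (1 + θ) / 2 with hσ
  have hσ0 : θ < σ := by rw [hσ]; linarith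
  have hσ1 : σ < 1 := by rw [hσ]; linarith
  obtain ⟨K, hK0, hK⟩ := BeurlingSystem.exists_hasSum_gaussKernel hfin hA.le hD hZ hσ0 hσ1
  choose h hsum hle using hK
  obtain ⟨B, -, hB⟩ := hZ.exists_norm_le hfin hD hσ0 hσ1
  obtain ⟨C₁, hC₁0, hC₁⟩ := exists_sum_integral_le_of_moment (p := 2 * k)
    (hZ.continuous_line hσ0 hσ1).norm (fun _ => norm_nonneg _) hB (by linarith) hc.le hCk
  obtain ⟨C₂, hC₂0, hC₂⟩ := exists_sum_exp_le_of_wellSpaced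
  set w₀ := Real.exp (-Real.log 2 ^ 2 / 2) with hw₀
  have hw₀0 : 0 < w₀ := Real.exp_pos _
  refine ⟨c / (2 * k), K * (C₁ + C₂) / w₀, fun T N R t a hT hN ht hsep => ?_⟩
  have hN0 : 0 < N := by linarith
  have hlT : 0 < Real.log T := Real.log_pos (by linarith)
  set L := Real.log N with hL
  set Y := T ^ (1 / (2 * k)) * (R : ℝ) ^ ((2 * k - 1) / (2 * k)) * Real.log T ^ (c / (2 * k))
    with hY
  have hY0 : 0 ≤ Y := by positivity
  have hrow : ∀ x : Fin R → ℝ, (∀ s, |x s| ≤ T) → (∀ r s, r ≠ s → 1 ≤ |x r - x s|) →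
      ∑ s, ‖h L (x s)‖ ≤ K * (C₁ + C₂) * (N + N ^ σ * Y) := fun x hxT hx => by
    have h1 : Real.exp L = N := Real.exp_log hN0
    have h2 : Real.exp (σ * L) = N ^ σ := by rw [Real.rpow_def_of_pos hN0, mul_comm]
    have h3 : ∑ s, Real.exp (-x s ^ 2 / 2) ≤ C₂ := by
      refine le_trans (Finset.sum_le_sum fun s _ => Real.exp_le_exp.2 ?_) (hC₂ R x hx 0)
      nlinarith [sq_nonneg (x s)]
    have h4 := hC₁ T R x hT hxT hx
    calc _ ≤ ∑ s, K * (N * Real.exp (-x s ^ 2 / 2) + N ^ σ *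
          ∫ v : ℝ, Real.exp (-v ^ 2 / 2) * ‖Z (σ + Complex.I * (v + x s : ℝ))‖) := by
          refine Finset.sum_le_sum fun s _ => ?_
          have := hle L (x s)
          rwa [h1, h2] at this
      _ = K * (N * ∑ s, Real.exp (-x s ^ 2 / 2) + N ^ σ * ∑ s,
          ∫ v : ℝ, Real.exp (-v ^ 2 / 2) * ‖Z (σ + Complex.I * (v + x s : ℝ))‖) := by
          rw [← Finset.mul_sum, Finset.sum_add_distrib, ← Finset.mul_sum, ← Finset.mul_sum]
      _ ≤ K * (N * C₂ + N ^ σ * (C₁ * Y)) := by gcongr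
      _ ≤ K * ((C₁ + C₂) * (N + N ^ σ * Y)) := by
          gcongr
          have h5 : 0 ≤ N ^ σ * Y := by positivity
          nlinarith [mul_nonneg hC₁0 hN0.le, mul_nonneg hC₂0 h5]
      _ = _ := by ring
  have hdiff : ∀ r s, |t r - t s| ≤ T := fun r s => by
    have h1 := ht r
    have h2 := ht s
    exact abs_le.2 ⟨by linarith [h1.1, h2.2], by linarith [h1.2, h2.1]⟩
  set J := (hfin (2 * N)).toFinset.filter fun j => N < S.n j with hJ
  have hmem : ∀ j, j ∈ J ↔ j ∈ {j : ℕ | N < S.n j ∧ S.n j ≤ 2 * N} := fun j => by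
    simp [hJ, and_comm]
  have htsum : ∀ {E : Type} [NormedAddCommGroup E] (f : ℕ → E),
      ∑' j, Set.indicator {j : ℕ | N < S.n j ∧ S.n j ≤ 2 * N} f j = ∑ j ∈ J, f j := by
    intro E _ f
    rw [tsum_eq_sum (s := J) fun j hj => Set.indicator_of_notMem (by rwa [← hmem]) _]
    exact Finset.sum_congr rfl fun j hj => Set.indicator_of_mem ((hmem j).1 hj) _
  have hpos : ∀ j, 0 < S.n j := fun j => one_pos.trans_le (S.one_le_n j)
  simp_rw [htsum]
  have hmain := large_sieve_of_gram_bound J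
    (w := fun j => Real.exp (-(Real.log (S.n j) - L) ^ 2 / 2)) (fun _ => (Real.exp_pos _).le)
    hw₀0.le (fun j hj => ?_)
    (fun (r : Fin R) j => (S.n j : ℂ) ^ (-(Complex.I * ((t r : ℝ) : ℂ))))
    (H := fun r s => h L (t r - t s)) (fun r s => ?_)
    (M := K * (C₁ + C₂) * (N + N ^ σ * Y)) (by positivity) (fun r => ?_) (fun s => ?_) a
  · rw [← le_div_iff₀' hw₀0] at hmain
    refine hmain.trans (le_of_eq ?_)
    rw [hY]
    ring
  · obtain ⟨h1, h2⟩ := (hmem j).1 hj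
    refine Real.exp_le_exp.2 ?_
    have h3 : 0 ≤ Real.log (S.n j) - L := sub_nonneg.2 (Real.log_le_log hN0 h1.le)
    have h4 : Real.log (S.n j) - L ≤ Real.log 2 := by
      have := Real.log_le_log (hpos j) h2
      rw [Real.log_mul two_ne_zero hN0.ne'] at this
      linarith
    have := pow_le_pow_left₀ h3 h4 2
    linarith
  · refine (congrArg (fun f => HasSum f _) (funext fun j => ?_)).mpr (hsum L (t r - t s))
    have hne : (S.n j : ℂ) ≠ 0 := by exact_mod_cast (hpos j).ne'
    rw [gaussKernel_eq, Complex.cpow_def_of_ne_zero hne, Complex.cpow_def_of_ne_zero hne,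
      ← Complex.ofReal_log (hpos j).le, Complex.star_def, ← Complex.exp_conj, ← Complex.exp_add]
    congr 2
    simp
    ring
  · refine hrow (fun s => t r - t s) (hdiff r) fun s s' hs => ?_
    rw [sub_sub_sub_cancel_left]
    exact hsep s' s hs.symm
  · refine hrow (fun r => t r - t s) (fun r => hdiff r s) fun r r' hr => ?_
    rw [sub_sub_sub_cancel_right]
    exact hsep r r' hr
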